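/- Let Λ be a finite subset of ℤ², with sites i, j ∈ Λ neighbors when |i − j| = 1, and let 0 ≤ s ≤ t. If the binary image X̂ satisfies C_{Y,s}(X̂) ≤ C_{Y,s}(Z) for every binary image Z on Λ (i.e. the cut 𝒞(X̂) has minimum capacity in the network N_s(Y)), then C_{X̂,t}(X̂) ≤ C_{X̂,t}(Z) for every binary image Z on Λ (i.e. the cut 𝒞(X̂) also has minimum capacity in the network N_t(X̂)). -/

import Mathlib

/-- Two sites of `ℤ²` are neighbors when `|i - j| = 1`. -/
abbrev Nbr (i j : ℤ × ℤ) : Prop :=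
  (i.1 - j.1).natAbs + (i.2 - j.2).natAbs = 1

/-- A fixed linear (lexicographic) order on `ℤ²`, used to count each unordered
pair exactly once. -/
abbrev OrdLt (i j : ℤ × ℤ) : Prop :=
  i.1 < j.1 ∨ (i.1 = j.1 ∧ i.2 < j.2)

/-- The number of unordered neighbor pairs `{i, j} ⊆ Λ` satisfying `Q i j`. -/
def nbrPairCount (Λ : Finset (ℤ × ℤ)) (Q : (ℤ × ℤ) → (ℤ × ℤ) → Prop)
    [DecidableRel Q] : ℕ :=
  ((Λ ×ˢ Λ).filter (fun p => OrdLt p.1 p.2 ∧ Nbr p.1 p.2 ∧ Q p.1 p.2)).card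

/-- The vertex set of the network: the sites of `ℤ²` (`Sum.inl i`) together with
a source `Sum.inr false` and a sink `Sum.inr true`. -/
abbrev V : Type := (ℤ × ℤ) ⊕ Bool

/-- The source `s`. -/
def src : V := Sum.inr false

/-- The sink `t`. -/
def snk : V := Sum.inr true

/-- Arc capacities of the network `N_α(Y)`: `c(s,i) = α` if `Y i = 1` (else `0`),
`c(i,t) = α` if `Y i = 0` (else `0`), `c(i,j) = 1` for each ordered pair of
neighbor sites of `Λ`, and all other arcs have capacity `0`. -/
noncomputable def cap (Λ : Finset (ℤ × ℤ)) (Y : (ℤ × ℤ) → Bool) (α : ℝ) :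
    V → V → ℝ
  | Sum.inr false, Sum.inl i => if i ∈ Λ ∧ Y i = true then α else 0
  | Sum.inl i, Sum.inr true => if i ∈ Λ ∧ Y i = false then α else 0
  | Sum.inl i, Sum.inl j => if i ∈ Λ ∧ j ∈ Λ ∧ Nbr i j then (1 : ℝ) else 0
  | _, _ => 0

/-- The arcs of the network: `(s,i)` and `(i,t)` for sites `i ∈ Λ`, and `(i,j)`
for ordered pairs of neighbor sites of `Λ`. -/
def isArc (Λ : Finset (ℤ × ℤ)) : V → V → Bool
  | Sum.inr false, Sum.inl i => decide (i ∈ Λ)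
  | Sum.inl i, Sum.inr true => decide (i ∈ Λ)
  | Sum.inl i, Sum.inl j => decide (i ∈ Λ ∧ j ∈ Λ ∧ Nbr i j)
  | _, _ => false

/-- Embedding of the sites into the vertex set. -/
def siteEmb : (ℤ × ℤ) ↪ V := ⟨Sum.inl, Sum.inl_injective⟩

/-- `A(X) = {s} ∪ {i ∈ Λ : X i = 1}`. -/
def Aset (Λ : Finset (ℤ × ℤ)) (X : (ℤ × ℤ) → Bool) : Finset V :=
  insert (Sum.inr false) ((Λ.filter (fun i => X i = true)).map siteEmb)

/-- `B(X) = {t} ∪ {i ∈ Λ : X i = 0}`. -/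
def Bset (Λ : Finset (ℤ × ℤ)) (X : (ℤ × ℤ) → Bool) : Finset V :=
  insert (Sum.inr true) ((Λ.filter (fun i => X i = false)).map siteEmb)

/-- The cut `𝒞(X)` determined by the binary image `X`: all arcs `(u,v)` of the
network with `u ∈ A(X)` and `v ∈ B(X)`. -/
def cutF (Λ : Finset (ℤ × ℤ)) (X : (ℤ × ℤ) → Bool) : Finset (V × V) :=
  (Aset Λ X ×ˢ Bset Λ X).filter (fun p => isArc Λ p.1 p.2 = true)

/-- The capacity `C_{Y,α}(X)` of the cut `𝒞(X)` in the network `N_α(Y)`. -/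
noncomputable def cutCap (Λ : Finset (ℤ × ℤ)) (Y : (ℤ × ℤ) → Bool) (α : ℝ)
    (X : (ℤ × ℤ) → Bool) : ℝ :=
  ∑ p ∈ cutF Λ X, cap Λ Y α p.1 p.2

/-- `D_{Y,α}(E) = Σ_{e ∈ E} c_{Y,α}(e)` for a set of arcs `E`. -/
noncomputable def Dsum (Λ : Finset (ℤ × ℤ)) (Y : (ℤ × ℤ) → Bool) (α : ℝ)
    (E : Finset (V × V)) : ℝ :=
  ∑ p ∈ E, cap Λ Y α p.1 p.2

/-- The number of sites of `Λ` at which the images `X` and `Y` differ. -/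
def imageDist (Λ : Finset (ℤ × ℤ)) (X Y : (ℤ × ℤ) → Bool) : ℕ :=
  (Λ.filter (fun i => X i ≠ Y i)).card

/-- The number of ordered neighbor pairs `(i, j)` of sites of `Λ` with `X i = 1` and `X j = 0`. -/
def boundaryLength (Λ : Finset (ℤ × ℤ)) (X : (ℤ × ℤ) → Bool) : ℕ :=
  ((Λ.filter (fun i => X i = true) ×ˢ Λ.filter (fun j => X j = false)).filter
    (fun p => Nbr p.1 p.2)).card

theorem imageDist_self (Λ : Finset (ℤ × ℤ)) (X : (ℤ × ℤ) → Bool) : imageDist Λ X X = 0 := by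
  simp [imageDist]

theorem imageDist_triangle (Λ : Finset (ℤ × ℤ)) (X Y Z : (ℤ × ℤ) → Bool) :
    imageDist Λ X Z ≤ imageDist Λ X Y + imageDist Λ Y Z := by
  refine le_trans (Finset.card_le_card fun i hi => ?_) (Finset.card_union_le _ _)
  simp only [Finset.mem_union, Finset.mem_filter] at hi ⊢
  grind

theorem cap_eq_zero_of_not_isArc (Λ : Finset (ℤ × ℤ)) (Y : (ℤ × ℤ) → Bool) (α : ℝ) (u v : V)
    (h : isArc Λ u v ≠ true) : cap Λ Y α u v = 0 := by
  rcases u with i | _ | _ <;> rcases v with j | _ | _ <;> simp_all [isArc, cap]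

theorem cutCap_eq_sum_product (Λ : Finset (ℤ × ℤ)) (Y : (ℤ × ℤ) → Bool) (α : ℝ)
    (X : (ℤ × ℤ) → Bool) :
    cutCap Λ Y α X = ∑ u ∈ Aset Λ X, ∑ v ∈ Bset Λ X, cap Λ Y α u v := by
  rw [cutCap, cutF, ← Finset.sum_product']
  refine Finset.sum_filter_of_ne fun p _ hp => ?_
  by_contra h
  exact hp (cap_eq_zero_of_not_isArc Λ Y α p.1 p.2 h)

/-- The capacity of a cut is a data term plus a boundary term. -/
theorem cutCap_eq (Λ : Finset (ℤ × ℤ)) (Y : (ℤ × ℤ) → Bool) (α : ℝ) (X : (ℤ × ℤ) → Bool) :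
    cutCap Λ Y α X = α * imageDist Λ Y X + boundaryLength Λ X := by
  have hsrc : ∑ j ∈ Λ.filter (fun j => X j = false), cap Λ Y α (Sum.inr false) (Sum.inl j) =
      ∑ j ∈ Λ, if X j = false ∧ Y j = true then α else 0 := by
    rw [Finset.sum_filter]
    refine Finset.sum_congr rfl fun j hj => ?_
    simp [cap, hj, ite_and]
  have hsnk : ∑ i ∈ Λ.filter (fun i => X i = true), cap Λ Y α (Sum.inl i) (Sum.inr true) =
      ∑ i ∈ Λ, if X i = true ∧ Y i = false then α else 0 := by
    rw [Finset.sum_filter]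
    refine Finset.sum_congr rfl fun i hi => ?_
    simp [cap, hi, ite_and]
  have hdist : α * imageDist Λ Y X =
      (∑ j ∈ Λ, if X j = false ∧ Y j = true then α else 0) +
        ∑ i ∈ Λ, if X i = true ∧ Y i = false then α else 0 := by
    rw [imageDist, ← Finset.sum_add_distrib, mul_comm, ← nsmul_eq_mul, ← Finset.sum_const,
      Finset.sum_filter]
    refine Finset.sum_congr rfl fun i _ => ?_
    cases X i <;> cases Y i <;> simp
  have hbdry : (boundaryLength Λ X : ℝ) =
      ∑ i ∈ Λ.filter (fun i => X i = true), ∑ j ∈ Λ.filter (fun j => X j = false),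
        cap Λ Y α (Sum.inl i) (Sum.inl j) := by
    rw [boundaryLength, Finset.natCast_card_filter, Finset.sum_product]
    refine Finset.sum_congr rfl fun i hi => Finset.sum_congr rfl fun j hj => ?_
    simp only [cap, (Finset.mem_filter.mp hi).1, (Finset.mem_filter.mp hj).1, true_and]
  have hst : cap Λ Y α (Sum.inr false) (Sum.inr true) = 0 := rfl
  have hA : Sum.inr false ∉ (Λ.filter (fun i => X i = true)).map siteEmb := by simp [siteEmb]
  have hB : Sum.inr true ∉ (Λ.filter (fun i => X i = false)).map siteEmb := by simp [siteEmb]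
  have hemb (i : ℤ × ℤ) : siteEmb i = Sum.inl i := rfl
  rw [cutCap_eq_sum_product, Aset, Bset, Finset.sum_insert hA]
  simp only [Finset.sum_insert hB, Finset.sum_map, hemb, Finset.sum_add_distrib]
  rw [hst, hsrc, hsnk, hdist, hbdry]
  ring

/-- If the cut `𝒞(X̂)` has minimum capacity in the network `N_s(Y)` and
`0 ≤ s ≤ t`, then `𝒞(X̂)` also has minimum capacity in the network `N_t(X̂)`. -/
theorem min_cut_fixed_point (Λ : Finset (ℤ × ℤ)) (s t : ℝ) (hs : 0 ≤ s)
    (hst : s ≤ t) (Y Xhat : (ℤ × ℤ) → Bool)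
    (hmin : ∀ Z : (ℤ × ℤ) → Bool, cutCap Λ Y s Xhat ≤ cutCap Λ Y s Z) :
    ∀ Z : (ℤ × ℤ) → Bool, cutCap Λ Xhat t Xhat ≤ cutCap Λ Xhat t Z := by
  intro Z
  have h := hmin Z
  have htri : (imageDist Λ Y Z : ℝ) ≤ imageDist Λ Y Xhat + imageDist Λ Xhat Z :=
    mod_cast imageDist_triangle Λ Y Xhat Z
  have hd : s * (imageDist Λ Xhat Z : ℝ) ≤ t * imageDist Λ Xhat Z := by gcongr
  simp only [cutCap_eq, imageDist_self, Nat.cast_zero, mul_zero, zero_add] at h ⊢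
  have := mul_le_mul_of_nonneg_left htri hs
  linarith
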